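/- For every integer n ≥ 8, T(2n,8) = (429/16384)·t(2n) − (99/4096)·t(2)·t(2n-2) + (15/4096)·t(4)·t(2n-4) − (1/12288)·t(6)·t(2n-6), where t(2m) = Σ_{k≥1} 1/(2k-1)^{2m}. -/

import Mathlib

open scoped BigOperators

/-- Depth-one multiple t-value: `t1 m = t(2m) = ∑_{k ≥ 1} 1/(2k-1)^{2m}`. -/
noncomputable def t1 (m : ℕ) : ℝ := ∑' k : ℕ, 1 / (2 * (k : ℝ) + 1) ^ (2 * m)

/-- Multiple t-value `t(s₀, …, s_{d-1})`, summed over `n₀ > n₁ > ⋯ > n_{d-1} ≥ 1`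
(encoded via `f i = n_i - 1`, so the odd number `2 n_i - 1` is `2 (f i) + 1`). -/
noncomputable def mtv (d : ℕ) (s : Fin d → ℕ) : ℝ :=
  ∑' f : {f : Fin d → ℕ // StrictAnti f}, ∏ i, 1 / (2 * (f.1 i : ℝ) + 1) ^ (s i)

/-- `Tsum n d = T(2n, d)`: the sum of all multiple t-values of weight `2n` and
depth `d` with all arguments even. -/
noncomputable def Tsum (n d : ℕ) : ℝ :=
  ∑ j ∈ (Finset.Nat.antidiagonalTuple d n).filter (fun j => ∀ i, 1 ≤ j i),
    mtv d (fun i => 2 * j i)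

open Finset Filter Topology

/-- The reciprocal square `1 / (2k+1)^2` of the `k`-th odd number. -/
noncomputable def oddInvSq (k : ℕ) : ℝ := 1 / (2 * (k : ℝ) + 1) ^ 2

lemma oddInvSq_nonneg (k : ℕ) : 0 ≤ oddInvSq k := by unfold oddInvSq; positivity

lemma oddInvSq_le_one (k : ℕ) : oddInvSq k ≤ 1 := by
  unfold oddInvSq
  rw [div_le_one (by positivity)]
  exact one_le_pow₀ (by linarith [(Nat.cast_nonneg k : (0 : ℝ) ≤ k)])

lemma oddInvSq_pow (k m : ℕ) : oddInvSq k ^ m = 1 / (2 * (k : ℝ) + 1) ^ (2 * m) := by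
  rw [oddInvSq, div_pow, one_pow, pow_mul]

/-- The strictly decreasing `d`-tuples of naturals below `N`. -/
noncomputable def antiTuples (N d : ℕ) : Finset {f : Fin d → ℕ // StrictAnti f} :=
  letI := Classical.decPred (fun f : Fin d → ℕ => StrictAnti f)
  (Fintype.piFinset fun _ => range N).subtype _

lemma mem_antiTuples {N d : ℕ} {f : {f : Fin d → ℕ // StrictAnti f}} :
    f ∈ antiTuples N d ↔ ∀ i, f.1 i < N := by
  simp [antiTuples]

lemma tendsto_antiTuples (d : ℕ) : Tendsto (fun N => antiTuples N d) atTop atTop := by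
  refine tendsto_atTop_finset_of_monotone (fun M N h f hf => ?_) fun f => ?_
  · rw [mem_antiTuples] at hf ⊢
    exact fun i => (hf i).trans_le h
  · refine ⟨∑ i, f.1 i + 1, mem_antiTuples.2 fun i => Nat.lt_succ_of_le ?_⟩
    exact single_le_sum (f := f.1) (fun _ _ => Nat.zero_le _) (mem_univ i)

lemma sum_antiTuples {R : Type*} [CommSemiring R] (F : ℕ → R) (N d : ℕ) :
    ∑ f ∈ antiTuples N d, ∏ i, F (f.1 i) = ∑ s ∈ powersetCard d (range N), ∏ k ∈ s, F k := by
  refine sum_bij (fun f _ => univ.image f.1) (fun f hf => ?_) (fun f _ g _ h => ?_)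
    (fun s hs => ?_) (fun f _ => ?_)
  · rw [mem_powersetCard]
    refine ⟨fun k hk => ?_, by simp [card_image_of_injective _ f.2.injective]⟩
    obtain ⟨i, -, rfl⟩ := mem_image.1 hk
    exact mem_range.2 (mem_antiTuples.1 hf i)
  · have h' : Set.range f.1 = Set.range g.1 := by
      simpa using congrArg (fun s : Finset ℕ => (s : Set ℕ)) h
    have hr := (StrictMono.range_inj (f := f.1 ∘ Fin.rev) (g := g.1 ∘ Fin.rev)
      (f.2.comp Fin.rev_strictAnti) (g.2.comp Fin.rev_strictAnti)).1 (by
        rw [Fin.rev_surjective.range_comp, Fin.rev_surjective.range_comp, h'])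
    ext i
    simpa using congrFun hr i.rev
  · obtain ⟨hsub, hcard⟩ := mem_powersetCard.1 hs
    refine ⟨⟨s.orderEmbOfFin hcard ∘ Fin.rev,
      (s.orderEmbOfFin hcard).strictMono.comp_strictAnti Fin.rev_strictAnti⟩, ?_, ?_⟩
    · exact mem_antiTuples.2 fun i => mem_range.1 (hsub (s.orderEmbOfFin_mem hcard _))
    · apply coe_injective
      rw [coe_image, coe_univ, Set.image_univ, Fin.rev_surjective.range_comp]
      simp
  · rw [prod_image fun a _ b _ h => f.2.injective h]

lemma summable_oddInvSq : Summable oddInvSq := by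
  have h : Summable fun k : ℕ => 1 / ((k : ℝ) + 1) ^ 2 := by
    exact_mod_cast (summable_nat_add_iff 1).2 (Real.summable_one_div_nat_pow.2 one_lt_two)
  refine h.of_nonneg_of_le oddInvSq_nonneg fun k => ?_
  unfold oddInvSq
  gcongr
  linarith [(Nat.cast_nonneg k : (0 : ℝ) ≤ k)]

/-- The sum of all `oddInvSq k`. -/
noncomputable def oddInvSqSum : ℝ := ∑' k, oddInvSq k

lemma sum_prod_antiTuples_le (N d : ℕ) :
    ∑ f ∈ antiTuples N d, ∏ i, oddInvSq (f.1 i) ≤ oddInvSqSum ^ d := by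
  calc ∑ f ∈ antiTuples N d, ∏ i, oddInvSq (f.1 i)
      = ∑ f ∈ (antiTuples N d).map (Function.Embedding.subtype _), ∏ i, oddInvSq (f i) := by
        rw [sum_map]; rfl
    _ ≤ ∑ f ∈ Fintype.piFinset fun _ : Fin d => range N, ∏ i, oddInvSq (f i) := by
        refine sum_le_sum_of_subset_of_nonneg (fun f hf => ?_)
          fun f _ _ => prod_nonneg fun i _ => oddInvSq_nonneg _
        obtain ⟨g, hg, rfl⟩ := mem_map.1 hf
        simpa using mem_antiTuples.1 hg
    _ = (∑ k ∈ range N, oddInvSq k) ^ d := by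
        rw [← prod_univ_sum]; simp
    _ ≤ oddInvSqSum ^ d :=
        pow_le_pow_left₀ (sum_nonneg fun k _ => oddInvSq_nonneg k)
          (summable_oddInvSq.sum_le_tsum _ fun k _ => oddInvSq_nonneg k) d

lemma summable_prod_oddInvSq (d : ℕ) :
    Summable fun f : {f : Fin d → ℕ // StrictAnti f} => ∏ i, oddInvSq (f.1 i) := by
  refine summable_of_sum_le (c := oddInvSqSum ^ d)
    (fun f => prod_nonneg fun i _ => oddInvSq_nonneg _) fun u => ?_
  obtain ⟨N, hN⟩ := ((tendsto_antiTuples d).eventually_ge_atTop u).exists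
  exact (sum_le_sum_of_subset_of_nonneg hN
    fun f _ _ => prod_nonneg fun i _ => oddInvSq_nonneg _).trans (sum_prod_antiTuples_le N d)

lemma tendsto_mtv {d : ℕ} (j : Fin d → ℕ) (hj : ∀ i, 1 ≤ j i) :
    Tendsto (fun N => ∑ f ∈ antiTuples N d, ∏ i, oddInvSq (f.1 i) ^ j i) atTop
      (𝓝 (mtv d fun i => 2 * j i)) := by
  have hs : Summable fun f : {f : Fin d → ℕ // StrictAnti f} =>
      ∏ i, oddInvSq (f.1 i) ^ j i :=
    (summable_prod_oddInvSq d).of_nonneg_of_le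
      (fun f => prod_nonneg fun i _ => pow_nonneg (oddInvSq_nonneg _) _)
      fun f => prod_le_prod (fun i _ => pow_nonneg (oddInvSq_nonneg _) _) fun i _ =>
        pow_le_of_le_one (oddInvSq_nonneg _) (oddInvSq_le_one _) (Nat.one_le_iff_ne_zero.1 (hj i))
  have := hs.hasSum.comp (tendsto_antiTuples d)
  simpa only [mtv, oddInvSq_pow, Function.comp_def] using this

/-- Elementary symmetric polynomial of degree `m` in the first `N` values of `oddInvSq`. -/
noncomputable def esymmTrunc (N m : ℕ) : ℝ :=
  ∑ s ∈ powersetCard m (range N), ∏ k ∈ s, oddInvSq k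

lemma esymmTrunc_nonneg (N m : ℕ) : 0 ≤ esymmTrunc N m :=
  sum_nonneg fun _ _ => prod_nonneg fun k _ => oddInvSq_nonneg k

lemma esymmTrunc_le (N m : ℕ) : esymmTrunc N m ≤ oddInvSqSum ^ m := by
  rw [esymmTrunc, ← sum_antiTuples]
  exact sum_prod_antiTuples_le N m

lemma tendsto_esymmTrunc (m : ℕ) :
    Tendsto (fun N => esymmTrunc N m) atTop (𝓝 (mtv m fun _ => 2 * 1)) := by
  simpa only [esymmTrunc, sum_antiTuples, pow_one] using
    tendsto_mtv (d := m) (fun _ => 1) fun _ => le_rfl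

/-- The power series `∑_{j ≥ 1} (oddInvSq k)^j X^j`. -/
noncomputable def geomSeries (k : ℕ) : PowerSeries ℝ :=
  PowerSeries.mk fun j => if j = 0 then 0 else oddInvSq k ^ j

/-- The generating series in the weight of the truncated depth `d` sums. -/
noncomputable def depthSeries (N d : ℕ) : PowerSeries ℝ :=
  ∑ s ∈ powersetCard d (range N), ∏ k ∈ s, geomSeries k

lemma coeff_prod_fin {R : Type*} [CommSemiring R] {d : ℕ} (G : Fin d → PowerSeries R) (n : ℕ) :
    PowerSeries.coeff n (∏ i, G i) =
      ∑ j ∈ Finset.Nat.antidiagonalTuple d n, ∏ i, PowerSeries.coeff (j i) (G i) := by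
  rw [PowerSeries.coeff_prod]
  refine sum_nbij' (fun l => ⇑l) Finsupp.equivFunOnFinite.symm ?_ ?_ ?_ ?_ ?_ <;>
    simp [mem_finsuppAntidiag, Finset.Nat.mem_antidiagonalTuple]

lemma tendsto_coeff_depthSeries (n d : ℕ) :
    Tendsto (fun N => PowerSeries.coeff n (depthSeries N d)) atTop (𝓝 (Tsum n d)) := by
  have h : ∀ N, PowerSeries.coeff n (depthSeries N d) =
      ∑ j ∈ (Finset.Nat.antidiagonalTuple d n).filter (fun j => ∀ i, 1 ≤ j i),
        ∑ f ∈ antiTuples N d, ∏ i, oddInvSq (f.1 i) ^ j i := fun N => by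
    rw [depthSeries, ← sum_antiTuples, map_sum, sum_comm]
    refine sum_congr rfl fun f _ => ?_
    rw [coeff_prod_fin, sum_filter]
    refine sum_congr rfl fun j _ => ?_
    split_ifs with hj
    · refine prod_congr rfl fun i _ => ?_
      simp [geomSeries, Nat.one_le_iff_ne_zero.1 (hj i)]
    · push Not at hj
      obtain ⟨i, hi⟩ := hj
      exact prod_eq_zero (mem_univ i) (by simp [geomSeries, Nat.lt_one_iff.1 hi])
  simp only [h]
  exact tendsto_finsetSum _ fun j hj => tendsto_mtv j (mem_filter.1 hj).2

lemma geomSeries_mul (k : ℕ) :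
    geomSeries k * (1 - PowerSeries.C (oddInvSq k) * PowerSeries.X) =
      PowerSeries.C (oddInvSq k) * PowerSeries.X := by
  ext n
  rw [mul_sub, mul_one, ← mul_assoc, mul_comm (geomSeries k)]
  rcases n with _ | _ | n <;>
    simp [geomSeries, mul_assoc, PowerSeries.coeff_succ_mul_X, pow_succ]
  ring

/-- The truncated Euler product `∏_{k < N} (1 - X / (2k+1)^2)`. -/
noncomputable def eulerProd (N : ℕ) : PowerSeries ℝ :=
  ∏ k ∈ range N, (1 - PowerSeries.C (oddInvSq k) * PowerSeries.X)

lemma coeff_prod_one_add_X_mul {R : Type*} [CommRing R] (g : ℕ → R) (N d : ℕ) :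
    (∏ k ∈ range N, (1 + Polynomial.X * Polynomial.C (g k))).coeff d =
      ∑ s ∈ powersetCard d (range N), ∏ k ∈ s, g k := by
  rw [prod_one_add, Polynomial.finsetSum_coeff, powersetCard_eq_filter, sum_filter]
  refine sum_congr rfl fun s _ => ?_
  rw [prod_mul_distrib, prod_const, ← map_prod, Polynomial.coeff_mul_C, Polynomial.coeff_X_pow]
  simp [eq_comm]

lemma coeff_eulerProd_mul_depthSeries (N d n : ℕ) :
    PowerSeries.coeff n (eulerProd N * depthSeries N d) =
      (-1) ^ (n + d) * (n.choose d : ℝ) * esymmTrunc N n := by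
  have key : Polynomial.C (eulerProd N) *
      ∏ k ∈ range N, (1 + Polynomial.X * Polynomial.C (geomSeries k)) =
      ∏ k ∈ range N, (1 + (Polynomial.X + Polynomial.C (-1)) *
        Polynomial.C (PowerSeries.C (oddInvSq k) * PowerSeries.X)) := by
    rw [eulerProd, map_prod, ← prod_mul_distrib]
    refine prod_congr rfl fun k _ => ?_
    have h := congrArg Polynomial.C (geomSeries_mul k)
    simp only [map_mul, map_sub, map_one, map_neg] at h ⊢
    linear_combination Polynomial.X * h
  have hd := congrArg (fun p => Polynomial.coeff p d) key
  simp only [Polynomial.coeff_C_mul, coeff_prod_one_add_X_mul] at hd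
  rw [depthSeries, hd, prod_one_add, Polynomial.finsetSum_coeff, map_sum, esymmTrunc,
    powersetCard_eq_filter, sum_filter, mul_sum]
  refine sum_congr rfl fun s _ => ?_
  rw [prod_mul_distrib, prod_const, ← map_prod, Polynomial.coeff_mul_C,
    Polynomial.coeff_X_add_C_pow, prod_mul_distrib, prod_const, ← map_prod]
  have hC : ((-1 : PowerSeries ℝ) ^ (#s - d) * ((#s).choose d : PowerSeries ℝ)) =
      PowerSeries.C ((-1) ^ (#s - d) * ((#s).choose d : ℝ)) := by simp
  rw [hC, PowerSeries.coeff_C_mul, PowerSeries.coeff_C_mul, PowerSeries.coeff_X_pow]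
  by_cases h : #s = n
  · subst h
    rcases lt_or_ge #s d with hlt | hle
    · simp [Nat.choose_eq_zero_of_lt hlt]
    · have : (-1 : ℝ) ^ (#s + d) = (-1) ^ (#s - d) := by
        obtain ⟨c, hc⟩ := Nat.exists_eq_add_of_le hle
        rw [hc, Nat.add_sub_cancel_left, show d + c + d = 2 * d + c by ring, pow_add, pow_mul]
        simp
      simp [this]
  · simp [h, Ne.symm h]

lemma coeff_eulerProd (N n : ℕ) :
    PowerSeries.coeff n (eulerProd N) = (-1) ^ n * esymmTrunc N n := by
  simpa [depthSeries] using coeff_eulerProd_mul_depthSeries N 0 n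

lemma prod_range_two_mul_sine (x : ℝ) (N : ℕ) :
    ∏ j ∈ range (2 * N), (1 - x ^ 2 / ((j : ℝ) + 1) ^ 2) =
      (∏ j ∈ range N, (1 - (x / 2) ^ 2 / ((j : ℝ) + 1) ^ 2)) *
        ∏ k ∈ range N, (1 - x ^ 2 * oddInvSq k) := by
  induction N with
  | zero => simp
  | succ N ih =>
    rw [show 2 * (N + 1) = 2 * N + 1 + 1 by ring, prod_range_succ, prod_range_succ, ih,
      prod_range_succ, prod_range_succ]
    have h : x ^ 2 / (((2 * N + 1 : ℕ) : ℝ) + 1) ^ 2 = (x / 2) ^ 2 / ((N : ℝ) + 1) ^ 2 := by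
      push_cast
      have : (N : ℝ) + 1 ≠ 0 := by positivity
      rw [show 2 * (N : ℝ) + 1 + 1 = 2 * (N + 1) by ring]
      field_simp
    have h' : x ^ 2 / (((2 * N : ℕ) : ℝ) + 1) ^ 2 = x ^ 2 * oddInvSq N := by
      rw [oddInvSq]
      push_cast
      ring
    rw [h, h']
    ring

lemma tendsto_prod_oddInvSq {x : ℝ} (h0 : 0 < x) (h1 : x < 1) :
    Tendsto (fun N => ∏ k ∈ range N, (1 - x ^ 2 * oddInvSq k)) atTop
      (𝓝 (Real.cos (Real.pi * x / 2))) := by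
  have hsin : 0 < Real.sin (Real.pi * (x / 2)) :=
    Real.sin_pos_of_pos_of_lt_pi (by positivity) (by nlinarith [Real.pi_pos])
  have hnum := (Real.tendsto_euler_sin_prod x).comp
    (tendsto_id.const_mul_atTop' (two_pos : (0 : ℕ) < 2))
  have hden := Real.tendsto_euler_sin_prod (x / 2)
  have hq := (hnum.div hden hsin.ne').div_const 2
  have hlim : Real.sin (Real.pi * x) / Real.sin (Real.pi * (x / 2)) / 2 =
      Real.cos (Real.pi * x / 2) := by
    rw [show Real.pi * x = 2 * (Real.pi * (x / 2)) by ring, Real.sin_two_mul,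
      show 2 * (Real.pi * (x / 2)) / 2 = Real.pi * (x / 2) by ring]
    rw [mul_right_comm, mul_div_cancel_right₀ _ hsin.ne', mul_div_cancel_left₀ _ two_ne_zero]
  rw [hlim] at hq
  refine hq.congr' ?_
  filter_upwards [hden.eventually_ne hsin.ne'] with N hN
  simp only [Pi.div_apply, Function.comp_apply, id]
  rw [prod_range_two_mul_sine, div_div, div_eq_iff (mul_ne_zero hN two_ne_zero)]
  ring

lemma prod_one_sub_eq_tsum (u : ℝ) (N : ℕ) :
    ∏ k ∈ range N, (1 - u * oddInvSq k) = ∑' m, esymmTrunc N m * (-u) ^ m := by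
  rw [tsum_eq_sum (s := range (N + 1)) fun m hm => ?_]
  · simp only [sub_eq_add_neg, prod_one_add, sum_powerset, card_range, esymmTrunc, sum_mul]
    refine sum_congr rfl fun m _ => sum_congr rfl fun s hs => ?_
    simp only [← neg_mul, prod_mul_distrib, prod_const, (mem_powersetCard.1 hs).2]
    ring
  · have : N < m := by simpa [Nat.lt_succ_iff] using hm
    simp [esymmTrunc, powersetCard_eq_empty.2 (show #(range N) < m by simpa using this)]

lemma coeff_eq_zero_of_tsum_eq_zero {b : ℕ → ℝ} {C K r : ℝ} (hK : 0 < K) (hr : 0 < r)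
    (hb : ∀ m, |b m| ≤ C * K ^ m) (h : ∀ u, 0 < u → u < r → ∑' m, b m * u ^ m = 0) (m : ℕ) :
    b m = 0 := by
  set p := FormalMultilinearSeries.ofScalars ℝ b with hp
  have hrad : 0 < p.radius := by
    refine lt_of_lt_of_le ?_ (p.le_radius_of_bound C (r := ⟨K⁻¹, by positivity⟩) fun n => ?_)
    · exact ENNReal.coe_pos.2 (show (0 : ℝ) < K⁻¹ by positivity)
    · rw [hp, FormalMultilinearSeries.ofScalars_norm, Real.norm_eq_abs]
      calc |b n| * (K⁻¹) ^ n ≤ C * K ^ n * (K⁻¹) ^ n := by gcongr; exact hb n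
        _ = C := by rw [mul_assoc, ← mul_pow, mul_inv_cancel₀ hK.ne', one_pow, mul_one]
  have hps : HasFPowerSeriesAt p.sum p 0 := ⟨_, p.hasFPowerSeriesOnBall hrad⟩
  have hfreq : ∃ᶠ u in 𝓝[≠] (0 : ℝ), p.sum u = 0 := by
    have hev : ∀ᶠ u in 𝓝[>] (0 : ℝ), p.sum u = 0 := by
      filter_upwards [Ioo_mem_nhdsGT hr] with u hu
      rw [← h u hu.1 hu.2]
      simpa [FormalMultilinearSeries.ofScalarsSum] using
        FormalMultilinearSeries.ofScalars_sum_eq (E := ℝ) b u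
    exact hev.frequently.filter_mono (nhdsWithin_mono _ fun u hu => ne_of_gt hu)
  have hz := hps.analyticAt.frequently_zero_iff_eventually_zero.1 hfreq
  have hp0 := hps.eq_zero_of_eventually hz
  exact congrFun ((FormalMultilinearSeries.ofScalars_series_eq_zero ℝ).1 hp0) m

lemma mtv_two (m : ℕ) :
    mtv m (fun _ => 2 * 1) = (Real.pi ^ 2 / 4) ^ m / (2 * m).factorial := by
  set p := oddInvSqSum with hpdef
  have hp : 0 ≤ p := tsum_nonneg oddInvSq_nonneg
  set A := Real.pi ^ 2 / 4 with hA
  have hA0 : 0 < A := by positivity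
  have hL0 : ∀ m, 0 ≤ mtv m (fun _ => 2 * 1) := fun m =>
    ge_of_tendsto' (tendsto_esymmTrunc m) fun N => esymmTrunc_nonneg N m
  have hL : ∀ m, mtv m (fun _ => 2 * 1) ≤ p ^ m := fun m =>
    le_of_tendsto' (tendsto_esymmTrunc m) fun N => esymmTrunc_le N m
  have hfac : ∀ m, A ^ m / (2 * m).factorial ≤ A ^ m := fun m =>
    div_le_self (by positivity) (by exact_mod_cast (2 * m).factorial_pos)
  have key : (-1 : ℝ) ^ m * (mtv m (fun _ => 2 * 1) - A ^ m / (2 * m).factorial) = 0 := by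
    refine coeff_eq_zero_of_tsum_eq_zero (C := 1) (K := p + A) (r := 1 / (p + 1))
      (b := fun m => (-1 : ℝ) ^ m * (mtv m (fun _ => 2 * 1) - A ^ m / (2 * m).factorial))
      (by positivity) (by positivity) (fun m => ?_) (fun u hu hur => ?_) m
    · rw [abs_mul, abs_pow, abs_neg, abs_one, one_pow, one_mul, one_mul]
      have h1 : p ^ m ≤ (p + A) ^ m := by gcongr; linarith
      have h2 : A ^ m ≤ (p + A) ^ m := by gcongr; linarith
      have h3 : 0 ≤ A ^ m / (2 * m).factorial := by positivity
      exact abs_sub_le_iff.2 ⟨by linarith [hL m], by linarith [hfac m, hL0 m]⟩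
    · have hup : u * p < 1 := by
        rw [lt_div_iff₀ (by positivity)] at hur
        linarith
      have hu1 : u < 1 := hur.trans_le ((div_le_one (by positivity)).2 (by linarith))
      have hbound : ∀ c : ℝ, ∀ m, 0 ≤ c → c ≤ p ^ m → ‖c * (-u) ^ m‖ ≤ (u * p) ^ m := by
        intro c m hc hcp
        rw [norm_mul, norm_pow, norm_neg, Real.norm_of_nonneg hc, Real.norm_of_nonneg hu.le,
          mul_pow, mul_comm]
        gcongr
      have hgeo : Summable fun m => (u * p) ^ m :=
        summable_geometric_of_lt_one (by positivity) hup
      have hlim := tendsto_tsum_of_dominated_convergence (𝓕 := atTop)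
        (f := fun N m => esymmTrunc N m * (-u) ^ m) hgeo
        (fun m => (tendsto_esymmTrunc m).mul_const ((-u) ^ m))
        (.of_forall fun N m => hbound _ m (esymmTrunc_nonneg N m) (esymmTrunc_le N m))
      simp only [← prod_one_sub_eq_tsum] at hlim
      have hcos := tendsto_prod_oddInvSq (Real.sqrt_pos.2 hu)
        ((Real.sqrt_lt' one_pos).2 (by simpa using hu1))
      simp only [Real.sq_sqrt hu.le] at hcos
      have heq := tendsto_nhds_unique hlim hcos
      have hsum : Summable fun m => mtv m (fun _ => 2 * 1) * (-u) ^ m :=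
        .of_norm_bounded hgeo fun m => hbound _ m (hL0 m) (hL m)
      have hc := Real.hasSum_cos (Real.pi * √u / 2)
      have hd := (hsum.hasSum.sub hc).tsum_eq
      rw [heq, sub_self] at hd
      rw [← hd]
      refine tsum_congr fun m => ?_
      have : (Real.pi * √u / 2) ^ (2 * m) = A ^ m * u ^ m := by
        rw [pow_mul, ← mul_pow, div_pow, mul_pow, Real.sq_sqrt hu.le, hA]
        ring
      rw [this, neg_pow]
      ring
  exact sub_eq_zero.1 ((mul_eq_zero.1 key).resolve_left (pow_ne_zero _ (by norm_num)))

/-- Taylor coefficients of `cos`: `(π/2)^(2m) / (2m)!`. -/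
noncomputable def cosCoeff (m : ℕ) : ℝ := (Real.pi ^ 2 / 4) ^ m / (2 * m).factorial

lemma cosCoeff_succ (m : ℕ) :
    (2 * m + 2) * (2 * m + 1) * cosCoeff (m + 1) = Real.pi ^ 2 / 4 * cosCoeff m := by
  have h : ((2 * (m + 1)).factorial : ℝ) = (2 * m + 2) * (2 * m + 1) * (2 * m).factorial := by
    rw [show 2 * (m + 1) = 2 * m + 1 + 1 by ring, Nat.factorial_succ, Nat.factorial_succ]
    push_cast
    ring
  have h0 : ((2 * m).factorial : ℝ) ≠ 0 := by positivity
  have h1 : (2 * m + 2 : ℝ) * (2 * m + 1) ≠ 0 := by positivity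
  rw [cosCoeff, cosCoeff, h, pow_succ]
  field_simp

/-- The series `cos (π √X / 2)`. -/
noncomputable def cosSeries : PowerSeries ℝ := PowerSeries.mk fun m => (-1) ^ m * cosCoeff m

/-- The generating series in `n` of `Tsum n d`. -/
noncomputable def tsumSeries (d : ℕ) : PowerSeries ℝ := PowerSeries.mk fun n => Tsum n d

lemma cosSeries_ne_zero : cosSeries ≠ 0 := fun h => by
  simpa [cosSeries, cosCoeff] using congrArg (PowerSeries.coeff 0) h

lemma coeff_cosSeries_mul_tsumSeries (d n : ℕ) :
    PowerSeries.coeff n (cosSeries * tsumSeries d) =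
      (-1) ^ (n + d) * (n.choose d : ℝ) * cosCoeff n := by
  have he : ∀ m, Tendsto (fun N => esymmTrunc N m) atTop (𝓝 (cosCoeff m)) := fun m => by
    simpa only [mtv_two, cosCoeff] using tendsto_esymmTrunc m
  have h1 : Tendsto (fun N => PowerSeries.coeff n (eulerProd N * depthSeries N d)) atTop
      (𝓝 (PowerSeries.coeff n (cosSeries * tsumSeries d))) := by
    simp only [PowerSeries.coeff_mul, coeff_eulerProd, cosSeries, tsumSeries,
      PowerSeries.coeff_mk]
    exact tendsto_finsetSum _ fun p _ =>
      ((he p.1).const_mul _).mul (tendsto_coeff_depthSeries p.2 d)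
  refine tendsto_nhds_unique h1 ?_
  simp only [coeff_eulerProd_mul_depthSeries]
  exact (he n).const_mul _

lemma choose_recurrence (n d : ℕ) :
    4 * (d + 2) * (d + 1) * ((n + 1).choose (d + 2) : ℝ) +
      (4 * d + 2) * (d + 1) * ((n + 1).choose (d + 1) : ℝ) =
      (2 * n + 2) * (2 * n + 1) * (n.choose d : ℝ) := by
  have h1 : ((n : ℝ) + 1) * n.choose d = (n + 1).choose (d + 1) * (d + 1) := by
    exact_mod_cast Nat.add_one_mul_choose_eq n d
  have h2 : ((n + 1).choose (d + 2) : ℝ) * (d + 2) = (n + 1).choose (d + 1) * (n - d) := by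
    rcases lt_or_ge n d with h | h
    · rw [Nat.choose_eq_zero_of_lt (by lia), Nat.choose_eq_zero_of_lt (by lia)]
      simp
    · rw [← Nat.cast_sub h, ← Nat.add_sub_add_right n 1 d]
      exact_mod_cast Nat.choose_succ_right_eq (n + 1) (d + 1)
  linear_combination 4 * (d + 1) * h2 - (4 * n + 2) * h1

lemma Tsum_recurrence (n d : ℕ) :
    4 * (d + 2) * (d + 1) * Tsum (n + 1) (d + 2) =
      (4 * d + 2) * (d + 1) * Tsum (n + 1) (d + 1) - Real.pi ^ 2 / 4 * Tsum n d := by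
  have h : cosSeries * (PowerSeries.C (4 * (d + 2) * (d + 1) : ℝ) * tsumSeries (d + 2) -
      PowerSeries.C ((4 * d + 2) * (d + 1) : ℝ) * tsumSeries (d + 1) +
      PowerSeries.C (Real.pi ^ 2 / 4) * (tsumSeries d * PowerSeries.X)) = 0 := by
    ext k
    rw [mul_add, mul_sub, mul_left_comm, mul_left_comm cosSeries, mul_left_comm cosSeries,
      ← mul_assoc cosSeries (tsumSeries d), map_add, map_sub, PowerSeries.coeff_C_mul,
      PowerSeries.coeff_C_mul, PowerSeries.coeff_C_mul]
    rcases k with _ | k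
    · simp [coeff_cosSeries_mul_tsumSeries, PowerSeries.coeff_zero_mul_X,
        -PowerSeries.coeff_zero_eq_constantCoeff]
    · rw [PowerSeries.coeff_succ_mul_X, coeff_cosSeries_mul_tsumSeries,
        coeff_cosSeries_mul_tsumSeries, coeff_cosSeries_mul_tsumSeries, map_zero]
      linear_combination -(-1) ^ (k + d) * cosCoeff (k + 1) * choose_recurrence k d -
        (-1) ^ (k + d) * (k.choose d : ℝ) * cosCoeff_succ k
  have h' := congrArg (PowerSeries.coeff (n + 1))
    ((mul_eq_zero.1 h).resolve_left cosSeries_ne_zero)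
  simp only [map_add, map_sub, PowerSeries.coeff_C_mul, PowerSeries.coeff_succ_mul_X,
    tsumSeries, PowerSeries.coeff_mk, map_zero] at h'
  linear_combination h'

lemma Tsum_zero_right {n : ℕ} (hn : n ≠ 0) : Tsum n 0 = 0 := by
  have h : cosSeries * (tsumSeries 0 - 1) = 0 := by
    ext k
    rw [mul_sub, map_sub, coeff_cosSeries_mul_tsumSeries]
    simp [cosSeries]
  have h' := congrArg (PowerSeries.coeff n) ((mul_eq_zero.1 h).resolve_left cosSeries_ne_zero)
  simpa [tsumSeries, PowerSeries.coeff_one, hn] using h'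

lemma Tsum_one_right {n : ℕ} (hn : n ≠ 0) : Tsum n 1 = t1 n := by
  have hs : Summable fun k => oddInvSq k ^ n := by
    refine summable_oddInvSq.of_nonneg_of_le (fun k => pow_nonneg (oddInvSq_nonneg k) n)
      fun k => pow_le_of_le_one (oddInvSq_nonneg k) (oddInvSq_le_one k) hn
  refine tendsto_nhds_unique (tendsto_coeff_depthSeries n 1) ?_
  simpa [depthSeries, powersetCard_one, geomSeries, hn, t1, oddInvSq_pow] using
    hs.hasSum.tendsto_sum_nat

lemma t1_one_two_three :
    t1 1 = (Real.pi ^ 2 / 4) / 2 ∧ t1 2 = (Real.pi ^ 2 / 4) ^ 2 / 6 ∧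
      t1 3 = (Real.pi ^ 2 / 4) ^ 3 / 15 := by
  have h0 := coeff_cosSeries_mul_tsumSeries 1 0
  have h1 := coeff_cosSeries_mul_tsumSeries 1 1
  have h2 := coeff_cosSeries_mul_tsumSeries 1 2
  have h3 := coeff_cosSeries_mul_tsumSeries 1 3
  rw [← Tsum_one_right one_ne_zero, ← Tsum_one_right two_ne_zero,
    ← Tsum_one_right three_ne_zero]
  simp only [PowerSeries.coeff_mul, Finset.Nat.antidiagonal_succ, cosSeries, tsumSeries,
    PowerSeries.coeff_mk, cosCoeff] at h0 h1 h2 h3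
  norm_num [Nat.factorial] at h0 h1 h2 h3
  rw [h0] at h1 h2 h3
  have e1 : Tsum 1 1 = (Real.pi ^ 2 / 4) / 2 := by linear_combination h1
  rw [e1] at h2 h3
  have e2 : Tsum 2 1 = (Real.pi ^ 2 / 4) ^ 2 / 6 := by linear_combination h2
  rw [e2] at h3
  exact ⟨e1, e2, by linear_combination h3⟩

/-- Sum formula for multiple t-values at even arguments of depth 8. -/
theorem T2n_depth_8 (n : ℕ) (hn : 8 ≤ n) :
    Tsum n 8 = 429 / 16384 * t1 n - 99 / 4096 * t1 1 * t1 (n - 1) + 15 / 4096 * t1 2 * t1 (n - 2) - 1 / 12288 * t1 3 * t1 (n - 3) := by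
  obtain ⟨m, rfl⟩ := Nat.exists_eq_add_of_le' hn
  obtain ⟨h1, h2, h3⟩ := t1_one_two_three
  have hrec : ∀ k d, Tsum (k + 1) (d + 2) = ((4 * d + 2) * (d + 1) * Tsum (k + 1) (d + 1) -
      Real.pi ^ 2 / 4 * Tsum k d) / (4 * (d + 2) * (d + 1)) := fun k d => by
    rw [eq_div_iff (by positivity), ← Tsum_recurrence]
    ring
  rw [h1, h2, h3]
  simp only [hrec, Nat.reduceAdd, zero_add, Nat.add_one_sub_one, Nat.reduceSubDiff]
  simp only [Tsum_one_right (Nat.succ_ne_zero _), Tsum_zero_right (Nat.succ_ne_zero _)]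
  push_cast
  ring
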